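/- There are infinitely many integers N ≥ 2 for which there exist integers k_1, k_2 with 1 ≤ k_1 < k_2 ≤ N − 1 such that the centroids C_{k_1,N} and C_{k_2,N} of the corresponding skeletons of the standard simplex in ℝ^N coincide. Equivalently, there are infinitely many integers N of the form N = (b² + ab + a²) − (b + a) − 1 with positive integers a < b satisfying 1 ≤ a² − 1 and b² − 1 ≤ N − 1. -/

import Mathlib

open MeasureTheory

/-- The vertices of the standard simplex in `ℝ^N`: the origin together with the standard
basis vectors `e_1, …, e_N`. -/
noncomputable def simplexVertex (N : ℕ) (i : Fin (N + 1)) : EuclideanSpace ℝ (Fin N) :=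
  if h : i = 0 then 0 else EuclideanSpace.single (i.pred h) 1

/-- The `k`-skeleton of the standard simplex in `ℝ^N`: the union of the convex hulls of
all `(k+1)`-element subsets of the vertex set `{0, e_1, …, e_N}`. -/
def simplexSkeleton (N k : ℕ) : Set (EuclideanSpace ℝ (Fin N)) :=
  ⋃ s ∈ {s : Finset (Fin (N + 1)) | s.card = k + 1}, convexHull ℝ (simplexVertex N '' ↑s)

/-- The centroid `C_{k,N}` of the `k`-skeleton of the standard simplex in `ℝ^N`: the
vector-valued integral of the identity over the skeleton with respect to `k`-dimensional
Hausdorff measure, divided by the total `k`-dimensional Hausdorff measure of the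
skeleton. -/
noncomputable def skeletonCentroid (N k : ℕ) : EuclideanSpace ℝ (Fin N) :=
  (μH[(k : ℝ)] (simplexSkeleton N k)).toReal⁻¹ •
    ∫ x in simplexSkeleton N k, x ∂(μH[(k : ℝ)])

/-- Barycentric coordinates with respect to the vertices of the standard simplex. -/
noncomputable def simplexBary (k : ℕ) : Fin (k + 1) → (EuclideanSpace ℝ (Fin k) →ᵃ[ℝ] ℝ) :=
  Fin.cons (AffineMap.const ℝ _ 1 - (∑ j, (EuclideanSpace.projₗ (𝕜 := ℝ) j)).toAffineMap)
    fun j => (EuclideanSpace.projₗ (𝕜 := ℝ) j).toAffineMap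

theorem simplexBary_zero {k : ℕ} (x : EuclideanSpace ℝ (Fin k)) :
    simplexBary k 0 x = 1 - ∑ j, x j := by
  simp [simplexBary]

theorem simplexBary_succ {k : ℕ} (j : Fin k) (x : EuclideanSpace ℝ (Fin k)) :
    simplexBary k j.succ x = x j := by
  simp [simplexBary]

theorem simplexVertex_zero (N : ℕ) : simplexVertex N 0 = 0 := by
  simp [simplexVertex]

theorem simplexVertex_succ {N : ℕ} (j : Fin N) :
    simplexVertex N j.succ = EuclideanSpace.single j 1 := by
  simp [simplexVertex]

theorem simplexBary_simplexVertex {k : ℕ} (i j : Fin (k + 1)) :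
    simplexBary k i (simplexVertex k j) = if i = j then 1 else 0 := by
  cases i using Fin.cases <;> cases j using Fin.cases <;>
    simp [simplexBary_zero, simplexBary_succ, simplexVertex_zero, simplexVertex_succ,
      Fin.succ_ne_zero, (Fin.succ_ne_zero _).symm]

theorem sum_simplexBary {k : ℕ} (x : EuclideanSpace ℝ (Fin k)) :
    ∑ i, simplexBary k i x = 1 := by
  simp [Fin.sum_univ_succ, simplexBary_zero, simplexBary_succ]

theorem affineMap_eq_sum_simplexBary {k : ℕ} {F : Type*} [AddCommGroup F] [Module ℝ F]
    (f : EuclideanSpace ℝ (Fin k) →ᵃ[ℝ] F) (x : EuclideanSpace ℝ (Fin k)) :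
    f x = ∑ i, simplexBary k i x • f (simplexVertex k i) := by
  have hdec (y : EuclideanSpace ℝ (Fin k)) : f y = f.linear y + f 0 := by
    simpa using f.map_vadd 0 y
  have hx : x = ∑ j, x j • EuclideanSpace.single j (1 : ℝ) := by
    ext i
    simp [Pi.single_apply]
  rw [Fin.sum_univ_succ, hdec x]
  conv_lhs => rw [hx]
  simp only [simplexBary_zero, simplexBary_succ, simplexVertex_zero, simplexVertex_succ, map_sum,
    map_smul, hdec (EuclideanSpace.single _ _), smul_add, Finset.sum_add_distrib, sub_smul,
    one_smul, Finset.sum_smul]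
  abel

theorem continuous_simplexBary {k : ℕ} (i : Fin (k + 1)) : Continuous (simplexBary k i) :=
  (simplexBary k i).continuous_of_finiteDimensional

/-- The affine map sending the vertices of the standard simplex to prescribed points. -/
noncomputable def simplexMap {k : ℕ} {F : Type*} [AddCommGroup F] [Module ℝ F]
    (w : Fin (k + 1) → F) : EuclideanSpace ℝ (Fin k) →ᵃ[ℝ] F :=
  (∑ j, (LinearMap.toSpanSingleton ℝ F (w j.succ - w 0)).comp
    (EuclideanSpace.projₗ (𝕜 := ℝ) j)).toAffineMap + AffineMap.const ℝ _ (w 0)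

theorem simplexMap_apply {k : ℕ} {F : Type*} [AddCommGroup F] [Module ℝ F]
    (w : Fin (k + 1) → F) (x : EuclideanSpace ℝ (Fin k)) :
    simplexMap w x = ∑ i, simplexBary k i x • w i := by
  have hproj (j : Fin k) : EuclideanSpace.projₗ (𝕜 := ℝ) j x = x j := rfl
  simp only [simplexMap, AffineMap.coe_add, LinearMap.coe_toAffineMap, AffineMap.coe_const,
    Pi.add_apply, LinearMap.coe_sum, Finset.sum_apply, LinearMap.comp_apply,
    LinearMap.toSpanSingleton_apply, hproj, Function.const_apply,
    Fin.sum_univ_succ, simplexBary_zero, simplexBary_succ, smul_sub, Finset.sum_sub_distrib,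
    sub_smul, one_smul, Finset.sum_smul]
  abel

theorem simplexMap_simplexVertex {k : ℕ} {F : Type*} [AddCommGroup F] [Module ℝ F]
    (w : Fin (k + 1) → F) (i : Fin (k + 1)) :
    simplexMap w (simplexVertex k i) = w i := by
  simp [simplexMap_apply, simplexBary_simplexVertex]

theorem simplexBary_simplexMap {k N : ℕ} (o : Fin (k + 1) → Fin (N + 1)) (j : Fin (N + 1))
    (x : EuclideanSpace ℝ (Fin k)) :
    simplexBary N j (simplexMap (simplexVertex N ∘ o) x) =
      ∑ i, if j = o i then simplexBary k i x else 0 := by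
  have := affineMap_eq_sum_simplexBary
    ((simplexBary N j).comp (simplexMap (simplexVertex N ∘ o))) x
  simpa [simplexMap_simplexVertex, simplexBary_simplexVertex] using this

theorem simplexBary_simplexMap_apply {k N : ℕ} {o : Fin (k + 1) → Fin (N + 1)}
    (ho : Function.Injective o) (i : Fin (k + 1)) (x : EuclideanSpace ℝ (Fin k)) :
    simplexBary N (o i) (simplexMap (simplexVertex N ∘ o) x) = simplexBary k i x := by
  simp [simplexBary_simplexMap, ho.eq_iff]

theorem simplexMap_injective {k N : ℕ} {o : Fin (k + 1) → Fin (N + 1)}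
    (ho : Function.Injective o) : Function.Injective (simplexMap (simplexVertex N ∘ o)) := by
  intro x y h
  ext j
  have := simplexBary_simplexMap_apply ho j.succ
  rw [← simplexBary_succ, ← simplexBary_succ, ← this, ← this, h]

/-- The full-dimensional standard simplex. -/
noncomputable def fullSimplex (k : ℕ) : Set (EuclideanSpace ℝ (Fin k)) :=
  convexHull ℝ (Set.range (simplexVertex k))

theorem image_fullSimplex {k : ℕ} {F : Type*} [AddCommGroup F] [Module ℝ F]
    (w : Fin (k + 1) → F) :
    simplexMap w '' fullSimplex k = convexHull ℝ (Set.range w) := by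
  rw [fullSimplex, AffineMap.image_convexHull, ← Set.range_comp]
  congr 2
  ext1 i
  exact simplexMap_simplexVertex w i

theorem mem_fullSimplex_of_nonneg {k : ℕ} {x : EuclideanSpace ℝ (Fin k)}
    (hx : ∀ i, 0 ≤ simplexBary k i x) : x ∈ fullSimplex k := by
  have h : x = _ := affineMap_eq_sum_simplexBary (AffineMap.id ℝ _) x
  rw [h]
  exact (convex_convexHull ℝ _).sum_mem (fun i _ => hx i) (sum_simplexBary x)
    fun i _ => subset_convexHull ℝ _ ⟨i, rfl⟩

theorem isCompact_fullSimplex (k : ℕ) : IsCompact (fullSimplex k) :=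
  (Set.finite_range _).isCompact_convexHull ℝ

theorem simplexBary_eq_zero_of_mem_convexHull {N : ℕ} {s : Set (Fin (N + 1))} {i : Fin (N + 1)}
    (hi : i ∉ s) {x : EuclideanSpace ℝ (Fin N)} (hx : x ∈ convexHull ℝ (simplexVertex N '' s)) :
    simplexBary N i x = 0 := by
  have h : simplexBary N i x ∈ convexHull ℝ (simplexBary N i '' (simplexVertex N '' s)) := by
    rw [← AffineMap.image_convexHull]
    exact ⟨x, hx, rfl⟩
  have h0 : simplexBary N i '' (simplexVertex N '' s) ⊆ {0} := by
    rintro _ ⟨_, ⟨j, hj, rfl⟩, rfl⟩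
    simp [simplexBary_simplexVertex, show i ≠ j from fun e => hi (e ▸ hj)]
  simpa using convexHull_mono h0 h

instance isAddHaarMeasure_hausdorff_euclidean (k : ℕ) :
    Measure.IsAddHaarMeasure (μH[(k : ℝ)] : Measure (EuclideanSpace ℝ (Fin k))) := by
  simpa using MeasureTheory.isAddHaarMeasure_hausdorffMeasure (E := EuclideanSpace ℝ (Fin k))

theorem fullSimplex_measure_pos (k : ℕ) : 0 < (μH[(k : ℝ)]).real (fullSimplex k) := by
  have hfin : μH[(k : ℝ)] (fullSimplex k) ≠ ⊤ := (isCompact_fullSimplex k).measure_lt_top.ne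
  refine ENNReal.toReal_pos (ne_of_gt ?_) hfin
  have hsub : {x | ∀ i, 0 < simplexBary k i x} ⊆ fullSimplex k :=
    fun x hx => mem_fullSimplex_of_nonneg fun i => (hx i).le
  refine lt_of_lt_of_le (IsOpen.measure_pos _ ?_ ?_) (measure_mono hsub)
  · simp only [Set.ofPred_forall]
    exact isOpen_iInter_of_finite fun i =>
      isOpen_lt continuous_const (continuous_simplexBary i)
  · refine ⟨WithLp.toLp 2 fun _ => (k + 1 : ℝ)⁻¹, fun i => ?_⟩
    cases i using Fin.cases with
    | zero =>
      simp only [simplexBary_zero, Finset.sum_const, Finset.card_univ, Fintype.card_fin,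
        nsmul_eq_mul]
      rw [sub_pos, ← div_eq_mul_inv, div_lt_one (by positivity)]
      linarith
    | succ j =>
      rw [simplexBary_succ]
      positivity

theorem simplexBary_zero_set_null {k : ℕ} (i : Fin (k + 1)) :
    μH[(k : ℝ)] {x | simplexBary k i x = 0} = 0 := by
  have h := Measure.addHaar_affineSubspace
    (μH[(k : ℝ)] : Measure (EuclideanSpace ℝ (Fin k)))
    ((AffineSubspace.mk' (0 : ℝ) ⊥).comap (simplexBary k i)) ?_
  · convert h using 2
    ext x
    simp [AffineSubspace.mem_mk']
  · intro htop
    have : simplexVertex k i ∈ (AffineSubspace.mk' (0 : ℝ) ⊥).comap (simplexBary k i) := by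
      rw [htop]; trivial
    simp [AffineSubspace.mem_mk', simplexBary_simplexVertex] at this

theorem simplexMap_linear_single {k : ℕ} {F : Type*} [AddCommGroup F] [Module ℝ F]
    (w : Fin (k + 1) → F) (j : Fin k) :
    (simplexMap w).linear (EuclideanSpace.single j 1) = w j.succ - w 0 := by
  have h := (simplexMap w).linearMap_vsub (simplexVertex k j.succ) (simplexVertex k 0)
  rw [simplexMap_simplexVertex, simplexMap_simplexVertex] at h
  simpa [simplexVertex_succ, simplexVertex_zero] using h

theorem inner_simplexVertex {N : ℕ} (a b : Fin (N + 1)) :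
    inner ℝ (simplexVertex N a) (simplexVertex N b) = if a = b ∧ a ≠ 0 then (1 : ℝ) else 0 := by
  cases a using Fin.cases <;> cases b using Fin.cases <;>
    simp [simplexVertex_zero, simplexVertex_succ, Fin.succ_ne_zero, (Fin.succ_ne_zero _).symm,
      EuclideanSpace.inner_single_left]

theorem normDet_simplexMap {k N : ℕ} (o : Fin (k + 1) ↪o Fin (N + 1)) :
    (simplexMap (simplexVertex N ∘ o)).linear.normDet =
      if o 0 = 0 then 1 else √(k + 1 : ℝ) := by
  have hpos := (simplexMap (simplexVertex N ∘ o)).linear.normDet_nonneg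
  have hne (j : Fin k) : o j.succ ≠ 0 := by
    have : o 0 < o j.succ := o.strictMono j.succ_pos
    exact (lt_of_le_of_lt (Fin.zero_le _) this).ne'
  have hne' (j : Fin k) : o j.succ ≠ o 0 := (o.strictMono j.succ_pos).ne'
  have h := (simplexMap (simplexVertex N ∘ o)).linear.normDet_sq_eq_det_gram
    (EuclideanSpace.basisFun (Fin k) ℝ)
  simp only [RCLike.ofReal_real_eq_id, id_eq, EuclideanSpace.basisFun_apply,
    simplexMap_linear_single] at h
  split_ifs with h0
  · have hg : Matrix.gram ℝ (fun j : Fin k => (simplexVertex N ∘ o) j.succ -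
        (simplexVertex N ∘ o) 0) = 1 := by
      ext i j
      simp [Matrix.gram_apply, h0, simplexVertex_zero, inner_simplexVertex, hne, Matrix.one_apply]
    rw [hg, Matrix.det_one] at h
    exact (pow_eq_one_iff_of_nonneg hpos two_ne_zero).mp h
  · have hnorm : ‖simplexVertex N (o 0)‖ = 1 := by
      rw [norm_eq_sqrt_real_inner, inner_simplexVertex]
      simp [h0]
    have hg : Matrix.gram ℝ (fun j : Fin k => (simplexVertex N ∘ o) j.succ -
        (simplexVertex N ∘ o) 0) =
        1 + Matrix.replicateCol Unit (fun _ => (1 : ℝ)) *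
          Matrix.replicateRow Unit (fun _ => (1 : ℝ)) := by
      ext i j
      simp [Matrix.gram_apply, h0, inner_simplexVertex, hne, hnorm,
        Matrix.one_apply, inner_sub_left, inner_sub_right, Matrix.mul_apply, hne', (hne' _).symm]
    rw [hg, Matrix.det_one_add_replicateCol_mul_replicateRow] at h
    rw [← Real.sqrt_sq hpos, h]
    simp [dotProduct, add_comm]

theorem hausdorffMeasure_image_affineMap {k N : ℕ}
    (g : EuclideanSpace ℝ (Fin k) →ᵃ[ℝ] EuclideanSpace ℝ (Fin N))
    (B : Set (EuclideanSpace ℝ (Fin k))) :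
    μH[(k : ℝ)] (g '' B) = ENNReal.ofReal g.linear.normDet * μH[(k : ℝ)] B := by
  have h := g.linear.hausdorffMeasure_image B
  rw [finrank_euclideanSpace_fin] at h
  rw [← h, ← (IsometryEquiv.addRight (g 0)).hausdorffMeasure_image _ (g.linear '' B),
    Set.image_image]
  congr 2
  ext1 x
  simpa using g.map_vadd 0 x

theorem setIntegral_image_affineMap {k N : ℕ}
    {g : EuclideanSpace ℝ (Fin k) →ᵃ[ℝ] EuclideanSpace ℝ (Fin N)}
    (hg : Function.Injective g) (T : Set (EuclideanSpace ℝ (Fin k)))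
    (f : EuclideanSpace ℝ (Fin N) → ℝ) :
    ∫ y in g '' T, f y ∂μH[(k : ℝ)] =
      g.linear.normDet * ∫ x in T, f (g x) ∂μH[(k : ℝ)] := by
  have hemb : MeasurableEmbedding g := g.continuous_of_finiteDimensional.measurableEmbedding hg
  have hμ : (μH[(k : ℝ)]).restrict (Set.range g) =
      ENNReal.ofReal g.linear.normDet • (μH[(k : ℝ)]).map g := by
    ext B hB
    rw [Measure.restrict_apply hB, Measure.smul_apply, hemb.map_apply,
      ← Set.image_preimage_eq_inter_range, hausdorffMeasure_image_affineMap, smul_eq_mul]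
  rw [← Measure.restrict_restrict_of_subset (Set.image_subset_range g T), hμ,
    Measure.restrict_smul, integral_smul_measure, hemb.setIntegral_map,
    Set.preimage_image_eq _ hg, ENNReal.toReal_ofReal g.linear.normDet_nonneg, smul_eq_mul]

theorem image_fullSimplex_perm {k : ℕ} (σ : Equiv.Perm (Fin (k + 1))) :
    simplexMap (simplexVertex k ∘ σ) '' fullSimplex k = fullSimplex k := by
  rw [image_fullSimplex, σ.surjective.range_comp, fullSimplex]

theorem normDet_simplexMap_perm {k : ℕ} (σ : Equiv.Perm (Fin (k + 1))) :
    (simplexMap (simplexVertex k ∘ σ)).linear.normDet = 1 := by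
  have h := hausdorffMeasure_image_affineMap (simplexMap (simplexVertex k ∘ σ)) (fullSimplex k)
  rw [image_fullSimplex_perm] at h
  have h' := congrArg ENNReal.toReal h
  rw [ENNReal.toReal_mul, ENNReal.toReal_ofReal (LinearMap.normDet_nonneg _)] at h'
  exact (mul_eq_right₀ (fullSimplex_measure_pos k).ne').mp h'.symm

theorem setIntegral_simplexBary {k : ℕ} (i : Fin (k + 1)) :
    ∫ x in fullSimplex k, simplexBary k i x ∂μH[(k : ℝ)] =
      (μH[(k : ℝ)]).real (fullSimplex k) / (k + 1) := by
  have hint (j : Fin (k + 1)) :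
      IntegrableOn (simplexBary k j) (fullSimplex k) μH[(k : ℝ)] :=
    (continuous_simplexBary j).continuousOn.integrableOn_compact (isCompact_fullSimplex k)
  have heq (j : Fin (k + 1)) : ∫ x in fullSimplex k, simplexBary k j x ∂μH[(k : ℝ)] =
      ∫ x in fullSimplex k, simplexBary k i x ∂μH[(k : ℝ)] := by
    have h := setIntegral_image_affineMap (simplexMap_injective (Equiv.swap i j).injective)
      (fullSimplex k) (simplexBary k j)
    rw [image_fullSimplex_perm, normDet_simplexMap_perm, one_mul] at h
    rw [h]
    congr 1
    ext1 x
    simpa using simplexBary_simplexMap_apply (Equiv.swap i j).injective i x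
  have hsum : ∑ j, ∫ x in fullSimplex k, simplexBary k j x ∂μH[(k : ℝ)] =
      (μH[(k : ℝ)]).real (fullSimplex k) := by
    rw [← integral_finsetSum _ fun j _ => hint j]
    simp [sum_simplexBary]
  simp only [heq, Finset.sum_const, Finset.card_univ, Fintype.card_fin, nsmul_eq_mul] at hsum
  rw [eq_div_iff (by positivity), ← hsum]
  push_cast
  ring

/-- The ratio of the `k`-dimensional volume of a face to that of a face containing the origin. -/
noncomputable def faceWeight {N : ℕ} (s : Finset (Fin (N + 1))) : ℝ :=
  if 0 ∈ s then 1 else √(s.card : ℝ)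

theorem image_simplexVertex_eq_range {k N : ℕ} {s : Finset (Fin (N + 1))} (hs : s.card = k + 1) :
    simplexVertex N '' s = Set.range (simplexVertex N ∘ s.orderEmbOfFin hs) := by
  rw [Set.range_comp, Finset.range_orderEmbOfFin]

theorem normDet_simplexMap_face {k N : ℕ} {s : Finset (Fin (N + 1))} (hs : s.card = k + 1) :
    (simplexMap (simplexVertex N ∘ s.orderEmbOfFin hs)).linear.normDet = faceWeight s := by
  rw [normDet_simplexMap, faceWeight, hs]
  have h : s.orderEmbOfFin hs 0 = 0 ↔ 0 ∈ s := by
    refine ⟨fun h => h ▸ s.orderEmbOfFin_mem hs 0, fun h => ?_⟩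
    rw [← Finset.mem_coe, ← s.range_orderEmbOfFin hs] at h
    obtain ⟨i, hi⟩ := h
    exact le_antisymm (hi ▸ (s.orderEmbOfFin hs).monotone (Fin.zero_le i)) (Fin.zero_le _)
  simp [h]

theorem face_eq_image_fullSimplex {k N : ℕ} {s : Finset (Fin (N + 1))} (hs : s.card = k + 1) :
    convexHull ℝ (simplexVertex N '' s) =
      simplexMap (simplexVertex N ∘ s.orderEmbOfFin hs) '' fullSimplex k := by
  rw [image_fullSimplex, image_simplexVertex_eq_range hs]

theorem isCompact_face {N : ℕ} (s : Finset (Fin (N + 1))) :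
    IsCompact (convexHull ℝ (simplexVertex N '' s)) :=
  (s.finite_toSet.image _).isCompact_convexHull ℝ

theorem measure_face {k N : ℕ} {s : Finset (Fin (N + 1))} (hs : s.card = k + 1) :
    μH[(k : ℝ)] (convexHull ℝ (simplexVertex N '' s)) =
      ENNReal.ofReal (faceWeight s) * μH[(k : ℝ)] (fullSimplex k) := by
  rw [face_eq_image_fullSimplex hs, hausdorffMeasure_image_affineMap, normDet_simplexMap_face]

theorem measure_face_ne_top {k N : ℕ} {s : Finset (Fin (N + 1))} (hs : s.card = k + 1) :
    μH[(k : ℝ)] (convexHull ℝ (simplexVertex N '' s)) ≠ ⊤ := by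
  rw [measure_face hs]
  exact ENNReal.mul_ne_top ENNReal.ofReal_ne_top (isCompact_fullSimplex k).measure_lt_top.ne

theorem faceWeight_nonneg {N : ℕ} (s : Finset (Fin (N + 1))) : 0 ≤ faceWeight s := by
  rw [faceWeight]
  split_ifs <;> positivity

theorem measureReal_face {k N : ℕ} {s : Finset (Fin (N + 1))} (hs : s.card = k + 1) :
    (μH[(k : ℝ)]).real (convexHull ℝ (simplexVertex N '' s)) =
      faceWeight s * (μH[(k : ℝ)]).real (fullSimplex k) := by
  rw [Measure.real, measure_face hs, ENNReal.toReal_mul,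
    ENNReal.toReal_ofReal (faceWeight_nonneg s), Measure.real]

theorem setIntegral_face_simplexBary {k N : ℕ} {s : Finset (Fin (N + 1))} (hs : s.card = k + 1)
    (j : Fin (N + 1)) :
    ∫ x in convexHull ℝ (simplexVertex N '' s), simplexBary N j x ∂μH[(k : ℝ)] =
      (if j ∈ s then faceWeight s else 0) *
        ((μH[(k : ℝ)]).real (fullSimplex k) / (k + 1)) := by
  split_ifs with hj
  · have ho : Function.Injective (s.orderEmbOfFin hs) := (s.orderEmbOfFin hs).injective
    rw [← Finset.mem_coe, ← s.range_orderEmbOfFin hs] at hj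
    obtain ⟨i, rfl⟩ := hj
    rw [face_eq_image_fullSimplex hs, setIntegral_image_affineMap (simplexMap_injective ho),
      normDet_simplexMap_face]
    simp only [simplexBary_simplexMap_apply ho, setIntegral_simplexBary]
  · rw [zero_mul]
    exact setIntegral_eq_zero_of_forall_eq_zero fun x hx =>
      simplexBary_eq_zero_of_mem_convexHull (by simpa using hj) hx

theorem aedisjoint_face {k N : ℕ} {s t : Finset (Fin (N + 1))} (hs : s.card = k + 1)
    (ht : t.card = k + 1) (hst : s ≠ t) :
    AEDisjoint μH[(k : ℝ)] (convexHull ℝ (simplexVertex N '' s))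
      (convexHull ℝ (simplexVertex N '' t)) := by
  have hnsub : ¬ s ⊆ t := fun h => hst (Finset.eq_of_subset_of_card_le h (by lia))
  obtain ⟨j, hj, hjt⟩ := Finset.not_subset.mp hnsub
  rw [← Finset.mem_coe, ← s.range_orderEmbOfFin hs] at hj
  obtain ⟨i, rfl⟩ := hj
  refine measure_mono_null (t := simplexMap (simplexVertex N ∘ s.orderEmbOfFin hs) ''
    {x | simplexBary k i x = 0}) ?_ ?_
  · rintro y ⟨hys, hyt⟩
    rw [face_eq_image_fullSimplex hs] at hys
    obtain ⟨x, -, rfl⟩ := hys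
    refine ⟨x, ?_, rfl⟩
    have h := simplexBary_eq_zero_of_mem_convexHull (by simpa using hjt) hyt
    rwa [simplexBary_simplexMap_apply (s.orderEmbOfFin hs).injective] at h
  · rw [hausdorffMeasure_image_affineMap, simplexBary_zero_set_null, mul_zero]

theorem simplexSkeleton_eq_biUnion (N k : ℕ) :
    simplexSkeleton N k = ⋃ s ∈ Finset.powersetCard (k + 1) (Finset.univ : Finset (Fin (N + 1))),
      convexHull ℝ (simplexVertex N '' s) := by
  simp [simplexSkeleton, Finset.mem_powersetCard]

theorem measureReal_simplexSkeleton (N k : ℕ) :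
    (μH[(k : ℝ)]).real (simplexSkeleton N k) =
      (∑ s ∈ Finset.powersetCard (k + 1) (Finset.univ : Finset (Fin (N + 1))), faceWeight s) *
        (μH[(k : ℝ)]).real (fullSimplex k) := by
  have hcard {s} (hs : s ∈ Finset.powersetCard (k + 1) (Finset.univ : Finset (Fin (N + 1)))) :
      s.card = k + 1 := (Finset.mem_powersetCard.mp hs).2
  rw [simplexSkeleton_eq_biUnion, measureReal_biUnion_finset₀ _ _
    fun s hs => measure_face_ne_top (hcard hs), Finset.sum_mul]
  · exact Finset.sum_congr rfl fun s hs => measureReal_face (hcard hs)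
  · exact fun s hs t ht hst => aedisjoint_face (hcard hs) (hcard ht) hst
  · exact fun s _ => (isCompact_face s).measurableSet.nullMeasurableSet

theorem isCompact_simplexSkeleton (N k : ℕ) : IsCompact (simplexSkeleton N k) := by
  rw [simplexSkeleton_eq_biUnion]
  exact (Finset.powersetCard _ _).isCompact_biUnion fun s _ => isCompact_face s

theorem measure_simplexSkeleton_ne_top (N k : ℕ) : μH[(k : ℝ)] (simplexSkeleton N k) ≠ ⊤ := by
  rw [simplexSkeleton_eq_biUnion]
  exact ((measure_biUnion_finset_le _ _).trans_lt (ENNReal.sum_lt_top.mpr fun s hs =>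
    (measure_face_ne_top (Finset.mem_powersetCard.mp hs).2).lt_top)).ne

theorem integrableOn_simplexSkeleton {N k : ℕ} {F : Type*} [NormedAddCommGroup F]
    {f : EuclideanSpace ℝ (Fin N) → F} (hf : Continuous f) :
    IntegrableOn f (simplexSkeleton N k) μH[(k : ℝ)] :=
  hf.continuousOn.integrableOn_of_subset_isCompact (isCompact_simplexSkeleton N k)
    (isCompact_simplexSkeleton N k).measurableSet subset_rfl (measure_simplexSkeleton_ne_top N k)

theorem setIntegral_biUnion_finset_ae {X ι F : Type*} [MeasurableSpace X] {μ : Measure X}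
    [NormedAddCommGroup F] [NormedSpace ℝ F] {f : X → F} {t : Finset ι} {s : ι → Set X}
    (hm : ∀ i ∈ t, NullMeasurableSet (s i) μ)
    (hd : (t : Set ι).Pairwise (Function.onFun (AEDisjoint μ) s))
    (hf : IntegrableOn f (⋃ i ∈ t, s i) μ) :
    ∫ x in ⋃ i ∈ t, s i, f x ∂μ = ∑ i ∈ t, ∫ x in s i, f x ∂μ := by
  have hU : ⋃ i ∈ t, s i = ⋃ i : {i // i ∈ t}, s i.1 :=
    (Set.iUnion_subtype (· ∈ t) fun i => s i.1).symm
  rw [hU] at hf ⊢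
  rw [integral_iUnion_ae (s := fun i : {i // i ∈ t} => s i.1) (fun i => hm i i.2)
    (fun i j hij => hd i.2 j.2 (Subtype.coe_ne_coe.mpr hij)) hf, tsum_fintype,
    ← Finset.sum_coe_sort t]

theorem setIntegral_simplexSkeleton_simplexBary (N k : ℕ) (j : Fin (N + 1)) :
    ∫ x in simplexSkeleton N k, simplexBary N j x ∂μH[(k : ℝ)] =
      (∑ s ∈ Finset.powersetCard (k + 1) (Finset.univ : Finset (Fin (N + 1))),
        if j ∈ s then faceWeight s else 0) *
        ((μH[(k : ℝ)]).real (fullSimplex k) / (k + 1)) := by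
  have hcard {s} (hs : s ∈ Finset.powersetCard (k + 1) (Finset.univ : Finset (Fin (N + 1)))) :
      s.card = k + 1 := (Finset.mem_powersetCard.mp hs).2
  have hint := integrableOn_simplexSkeleton (k := k) (continuous_simplexBary j)
  rw [simplexSkeleton_eq_biUnion] at hint ⊢
  rw [setIntegral_biUnion_finset_ae
    (fun s _ => (isCompact_face s).measurableSet.nullMeasurableSet)
    (fun s hs t ht hst => aedisjoint_face (hcard hs) (hcard ht) hst) hint, Finset.sum_mul]
  exact Finset.sum_congr rfl fun s hs => setIntegral_face_simplexBary (hcard hs) j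

theorem skeletonCentroid_apply {N k : ℕ} (j : Fin N) :
    skeletonCentroid N k j =
      (∑ s ∈ Finset.powersetCard (k + 1) (Finset.univ : Finset (Fin (N + 1))),
        if j.succ ∈ s then faceWeight s else 0) /
      ((k + 1) * ∑ s ∈ Finset.powersetCard (k + 1) (Finset.univ : Finset (Fin (N + 1))),
        faceWeight s) := by
  have h : (∫ x in simplexSkeleton N k, x ∂μH[(k : ℝ)]) j =
      ∫ x in simplexSkeleton N k, simplexBary N j.succ x ∂μH[(k : ℝ)] := by
    have h := (EuclideanSpace.proj j : EuclideanSpace ℝ (Fin N) →L[ℝ] ℝ).integral_comp_comm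
      (integrableOn_simplexSkeleton (k := k) continuous_id)
    simp only [simplexBary_succ]
    exact h.symm
  have hm := (fullSimplex_measure_pos k).ne'
  rw [skeletonCentroid, PiLp.smul_apply, h, setIntegral_simplexSkeleton_simplexBary,
    ← Measure.real, measureReal_simplexSkeleton, smul_eq_mul]
  field_simp

theorem card_filter_mem_powersetCard {α : Type*} [DecidableEq α] {t : Finset α} {a : α}
    (ha : a ∈ t) (k : ℕ) :
    ((Finset.powersetCard (k + 1) t).filter (a ∈ ·)).card = (t.card - 1).choose k := by
  have h := Finset.card_filter_add_card_filter_not (s := Finset.powersetCard (k + 1) t) (a ∈ ·)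
  have hnot : (Finset.powersetCard (k + 1) t).filter (a ∉ ·) =
      Finset.powersetCard (k + 1) (t.erase a) := by
    ext s
    simp only [Finset.mem_filter, Finset.mem_powersetCard, Finset.subset_erase]
    tauto
  have hpos := Finset.card_pos.mpr ⟨a, ha⟩
  rw [hnot, Finset.card_powersetCard, Finset.card_powersetCard, Finset.card_erase_of_mem ha] at h
  obtain ⟨n, hn⟩ := Nat.exists_eq_add_of_lt hpos
  rw [hn] at h ⊢
  simp only [zero_add, Nat.add_sub_cancel, Nat.choose_succ_succ] at h ⊢
  lia

theorem sum_faceWeight_ite (N k : ℕ) (p : Finset (Fin (N + 1)) → Prop) [DecidablePred p] :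
    (∑ s ∈ Finset.powersetCard (k + 1) (Finset.univ : Finset (Fin (N + 1))),
      if p s then faceWeight s else 0) =
      (((Finset.powersetCard (k + 1) Finset.univ).filter p).filter (0 ∈ ·)).card +
      √(k + 1 : ℝ) *
        (((Finset.powersetCard (k + 1) Finset.univ).filter p).filter (0 ∉ ·)).card := by
  rw [← Finset.sum_filter, ← Finset.sum_filter_add_sum_filter_not _ (0 ∈ ·)]
  congr 1
  · rw [Finset.card_eq_sum_ones, Nat.cast_sum]
    refine Finset.sum_congr rfl fun s hs => ?_
    simp [faceWeight, (Finset.mem_filter.mp hs).2]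
  · rw [Finset.sum_congr rfl (g := fun _ => √(k + 1 : ℝ))]
    · simp [mul_comm]
    · intro s hs
      simp only [Finset.mem_filter, Finset.mem_powersetCard] at hs
      simp [faceWeight, hs.2, hs.1.1.2]

theorem filter_filter_zero_notMem {N k : ℕ} (p : Finset (Fin (N + 1)) → Prop) [DecidablePred p] :
    ((Finset.powersetCard k Finset.univ).filter p).filter (0 ∉ ·) =
      (Finset.powersetCard k (Finset.univ.erase 0)).filter p := by
  ext s
  simp only [Finset.mem_filter, Finset.mem_powersetCard, Finset.subset_erase]
  tauto

theorem sum_faceWeight (N k : ℕ) :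
    ∑ s ∈ Finset.powersetCard (k + 1) (Finset.univ : Finset (Fin (N + 1))), faceWeight s =
      N.choose k + √(k + 1 : ℝ) * N.choose (k + 1) := by
  have h := sum_faceWeight_ite N k fun _ => True
  rw [filter_filter_zero_notMem] at h
  simp only [if_true, Finset.filter_true] at h
  rw [h, card_filter_mem_powersetCard (Finset.mem_univ _)]
  simp

theorem sum_faceWeight_mem (n l : ℕ) {j : Fin (n + 2)} (hj : j ≠ 0) :
    (∑ s ∈ Finset.powersetCard (l + 2) (Finset.univ : Finset (Fin (n + 2))),
      if j ∈ s then faceWeight s else 0) =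
      n.choose l + √(l + 2 : ℝ) * n.choose (l + 1) := by
  have h := sum_faceWeight_ite (n + 1) (l + 1) (j ∈ ·)
  have hnot : ((Finset.powersetCard (l + 2) (Finset.univ.erase (0 : Fin (n + 2)))).filter
      (j ∈ ·)).card = n.choose (l + 1) := by
    rw [card_filter_mem_powersetCard (by simpa using hj)]
    simp
  have hadd := Finset.card_filter_add_card_filter_not
    (s := (Finset.powersetCard (l + 2) (Finset.univ : Finset (Fin (n + 2)))).filter (j ∈ ·))
    (0 ∈ ·)
  rw [filter_filter_zero_notMem, hnot, card_filter_mem_powersetCard (Finset.mem_univ _),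
    Finset.card_univ, Fintype.card_fin, show n + 2 - 1 = n + 1 by lia,
    Nat.choose_succ_succ, Nat.add_right_cancel_iff] at hadd
  rw [filter_filter_zero_notMem, hnot, hadd] at h
  rw [h]
  push_cast
  ring_nf

/-- Closed form of the coordinates of the centroid of a skeleton. -/
theorem skeletonCentroid_apply_eq {N k : ℕ} (hk : 1 ≤ k) (hkN : k ≤ N) (j : Fin N) {s : ℝ}
    (hs : 0 < s) (hsk : s ^ 2 = k + 1) :
    skeletonCentroid N k j = (k + s * (N - k)) / (N * s * (s + (N - k))) := by
  obtain ⟨l, rfl⟩ := Nat.exists_eq_add_of_le' hk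
  obtain ⟨n, rfl⟩ := Nat.exists_eq_add_of_le' (hk.trans hkN)
  have hsqrt : √(l + 2 : ℝ) = s := by
    rw [← Real.sqrt_sq hs.le, hsk]
    congr 1
    push_cast
    ring
  have hln : l ≤ n := by lia
  have hc : (0 : ℝ) < n.choose l := by exact_mod_cast Nat.choose_pos hln
  have h1 : ((n + 1).choose (l + 1) : ℝ) * (l + 1) = (n + 1) * n.choose l := by
    exact_mod_cast (Nat.add_one_mul_choose_eq n l).symm
  have h2 : ((n + 1).choose (l + 2) : ℝ) * (l + 2) = (n + 1) * n.choose (l + 1) := by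
    exact_mod_cast (Nat.add_one_mul_choose_eq n (l + 1)).symm
  have h3 : (n.choose (l + 1) : ℝ) * (l + 1) = n.choose l * (n - l) := by
    rw [← Nat.cast_sub hln]
    exact_mod_cast Nat.choose_succ_right_eq n l
  have hnl : (0 : ℝ) ≤ n - l := by
    rw [sub_nonneg]
    exact_mod_cast hln
  have hsq : (l : ℝ) + 2 = s ^ 2 := by
    rw [hsk]
    push_cast
    ring
  rw [skeletonCentroid_apply, sum_faceWeight_mem n l (Fin.succ_ne_zero j), sum_faceWeight]
  rw [show ((l + 1 : ℕ) : ℝ) + 1 = l + 2 by push_cast; ring, hsqrt]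
  rw [← eq_div_iff (by positivity)] at h1 h2 h3
  rw [h1, show l + 1 + 1 = l + 2 from rfl, h2, h3, hsq]
  push_cast
  rw [show (n : ℝ) + 1 - (l + 1) = n - l by ring]
  generalize (n : ℝ) - l = d at *
  field_simp

/-- There are infinitely many integers `N ≥ 2` for which two distinct intermediate
skeletons of the standard simplex in `ℝ^N` share the same centroid. -/
theorem infinitely_many_dimensions_with_coincidence :
    {N : ℕ | 2 ≤ N ∧ ∃ k₁ k₂ : ℕ, 1 ≤ k₁ ∧ k₁ < k₂ ∧ k₂ ≤ N - 1 ∧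
      skeletonCentroid N k₁ = skeletonCentroid N k₂}.Infinite := by
  refine Set.infinite_of_injective_forall_mem (f := fun n : ℕ => (n + 3) ^ 2 + (n + 3) + 1)
    (fun m n h => ?_) fun n => ?_
  · simp only at h
    nlinarith [h]
  · have h9 : 3 ^ 2 ≤ (n + 3) ^ 2 := Nat.pow_le_pow_left (by lia) 2
    obtain ⟨k, hk⟩ : ∃ k, (n + 3) ^ 2 = k + 1 := Nat.exists_eq_add_of_le' (by lia)
    have hk4 : 3 < k := by lia
    have hkR : ((n : ℝ) + 3) ^ 2 = k + 1 := by exact_mod_cast hk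
    refine ⟨by lia, 3, k, by simp, hk4, by lia, ?_⟩
    ext j
    rw [skeletonCentroid_apply_eq (s := 2) (by simp) (by lia) j (by simp) (by norm_num),
      skeletonCentroid_apply_eq (s := n + 3) (by lia) (by lia) j (by positivity) hkR]
    have hk' : (k : ℝ) = (n + 3) ^ 2 - 1 := by linarith
    push_cast
    rw [hk']
    have hn : (0 : ℝ) ≤ n := n.cast_nonneg
    rw [div_eq_div_iff]
    · ring
    · refine (mul_pos (by positivity) ?_).ne'
      nlinarith
    · refine (mul_pos (by positivity) ?_).ne'
      nlinarith
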